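/- arXiv:2402.04250 — 2 statements merged into one kernel-verified Lean document; each statement's English description precedes it below -/
import Mathlib

section
/- For every α > 0, the function h_NCF(s) = α·(1/√(1−s) + 2/(1 + exp(−20s)) − 2) is not convex on the interval [0,1); that is, there exist points s₁, s₂ ∈ [0,1) and λ ∈ (0,1) such that h_NCF(λs₁ + (1−λ)s₂) > λ·h_NCF(s₁) + (1−λ)·h_NCF(s₂). -/
/-- For every `α > 0`, the nonconvex cybersecurity cost function
`h_NCF(s) = α(1/√(1−s) + 2/(1 + exp(−20s)) − 2)` is not convex on `[0,1)`:
there are points `s₁, s₂ ∈ [0,1)` and `λ ∈ (0,1)` witnessing a violation of the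
convexity inequality. -/
theorem hNCF_not_convex (α : ℝ) (hα : 0 < α) :
    ∃ s₁ ∈ Set.Ico (0:ℝ) 1, ∃ s₂ ∈ Set.Ico (0:ℝ) 1, ∃ l : ℝ,
      0 < l ∧ l < 1 ∧
      (fun s => α * (1 / Real.sqrt (1 - s) + 2 / (1 + Real.exp (-20 * s)) - 2))
          (l * s₁ + (1 - l) * s₂) >
        l * (fun s => α * (1 / Real.sqrt (1 - s) + 2 / (1 + Real.exp (-20 * s)) - 2)) s₁ +
        (1 - l) * (fun s => α * (1 / Real.sqrt (1 - s) + 2 / (1 + Real.exp (-20 * s)) - 2)) s₂ := by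
  refine ⟨0, by norm_num, 9 / 25, by norm_num, 1 / 2, by norm_num, by norm_num, ?_⟩
  have h_sqrt : Real.sqrt (1 - 9 / 25) = 4 / 5 := by
    rw [Real.sqrt_eq_iff_mul_self_eq] <;> norm_num
  have h_end : 2 / (1 + Real.exp (-20 * (9 / 25))) ≤ 2 := by
    rw [div_le_iff₀ (by positivity)]
    linarith [Real.exp_pos (-20 * (9 / 25))]
  have h_mid_sqrt : 1 ≤ 1 / Real.sqrt (1 - 9 / 50) := by
    rw [le_div_iff₀ (Real.sqrt_pos.2 (by norm_num)), one_mul, Real.sqrt_le_one]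
    norm_num
  have h_exp : Real.exp (-20 * (9 / 50)) ≤ 5 / 23 := by
    have h := Real.add_one_le_exp (18 / 5 : ℝ)
    rw [show (-20 * (9 / 50) : ℝ) = -(18 / 5) by norm_num, Real.exp_neg,
      inv_le_comm₀ (Real.exp_pos _) (by norm_num)]
    linarith
  have h_mid : 23 / 14 ≤ 2 / (1 + Real.exp (-20 * (9 / 50))) := by
    rw [le_div_iff₀ (by positivity)]
    linarith
  have h_point : (1 / 2 * 0 + (1 - 1 / 2) * (9 / 25) : ℝ) = 9 / 50 := by norm_num
  beta_reduce
  rw [h_point]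
  simp only [h_sqrt, sub_zero, Real.sqrt_one, mul_zero, Real.exp_zero]
  have h_left := mul_le_mul_of_nonneg_left
    (sub_le_sub_right (add_le_add h_mid_sqrt h_mid) 2) hα.le
  have h_right := mul_le_mul_of_nonneg_left
    (sub_le_sub_right (add_le_add_right h_end (1 / (4 / 5))) 2) hα.le
  linarith
end

section
/- Let M be a finite set of players and, for each player p ∈ M, let X^p be a nonempty finite strategy set. Let Π^p and Π̂^p be payoff functions on the product ∏_{q∈M} X^q such that for every player p and every pure strategy profile x, |Π^p(x) − Π̂^p(x)| ≤ δ (where δ ≥ 0). If the game with payoffs Π̂^p admits a mixed-strategy Nash equilibrium (a 0-equilibrium), then the game with payoffs Π^p admits a mixed-strategy 2δ-equilibrium. -/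
/-- The expected payoff of a payoff function `pay` under a mixed-strategy
profile `σ`: the sum over all pure strategy profiles `x` of the probability
`∏ q, σ q (x q)` times the payoff `pay x`. -/
noncomputable def expectedPayoff {M : Type*} [Fintype M] [DecidableEq M]
    {X : M → Type*} [∀ p, Fintype (X p)]
    (pay : (∀ q, X q) → ℝ) (σ : ∀ p, X p → ℝ) : ℝ :=
  ∑ x : ∀ q, X q, (∏ q, σ q (x q)) * pay x

/-- The point mass (pure strategy `y` played with probability 1). -/
def pointMass {Y : Type*} [DecidableEq Y] (y : Y) : Y → ℝ :=
  fun z => if z = y then 1 else 0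

/-- Uniformly `δ`-close payoff functions have `δ`-close expected payoffs under every
mixed-strategy profile. -/
theorem abs_expectedPayoff_sub_le {M : Type*} [Fintype M] [DecidableEq M]
    {X : M → Type*} [∀ p, Fintype (X p)] {f g : (∀ q, X q) → ℝ} {δ : ℝ}
    (hfg : ∀ x, |f x - g x| ≤ δ) {σ : ∀ p, X p → ℝ}
    (hσ : ∀ p y, 0 ≤ σ p y) (hσ_sum : ∀ p, ∑ y, σ p y = 1) :
    |expectedPayoff f σ - expectedPayoff g σ| ≤ δ := by
  have hprod : ∀ x : ∀ q, X q, 0 ≤ ∏ q, σ q (x q) :=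
    fun x => Finset.prod_nonneg fun q _ => hσ q (x q)
  have htotal : ∑ x : ∀ q, X q, ∏ q, σ q (x q) = 1 := by
    rw [← Fintype.piFinset_univ, ← Finset.prod_univ_sum]
    simp [hσ_sum]
  calc |expectedPayoff f σ - expectedPayoff g σ|
      = |∑ x : ∀ q, X q, (∏ q, σ q (x q)) * (f x - g x)| := by
        simp only [expectedPayoff, mul_sub, Finset.sum_sub_distrib]
    _ ≤ ∑ x : ∀ q, X q, |(∏ q, σ q (x q)) * (f x - g x)| := Finset.abs_sum_le_sum_abs _ _
    _ ≤ ∑ x : ∀ q, X q, (∏ q, σ q (x q)) * δ := by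
        refine Finset.sum_le_sum fun x _ => ?_
        rw [abs_mul, abs_of_nonneg (hprod x)]
        exact mul_le_mul_of_nonneg_left (hfg x) (hprod x)
    _ = δ := by rw [← Finset.sum_mul, htotal, one_mul]

theorem pointMass_nonneg {Y : Type*} [DecidableEq Y] (y z : Y) : 0 ≤ pointMass y z := by
  unfold pointMass
  split_ifs <;> norm_num

theorem sum_pointMass {Y : Type*} [Fintype Y] [DecidableEq Y] (y : Y) :
    ∑ z, pointMass y z = 1 := by
  simp [pointMass]

/-- If a finite game with payoffs `pay'` (a `δ`-absolute
approximation of `pay` on pure strategy profiles) admits a mixed-strategy Nash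
equilibrium, then the game with payoffs `pay` admits a mixed-strategy
`2δ`-equilibrium. -/
theorem exists_two_delta_mixed_equilibrium
    {M : Type*} [Fintype M] [DecidableEq M]
    {X : M → Type*} [∀ p, Fintype (X p)] [∀ p, DecidableEq (X p)]
    [∀ p, Nonempty (X p)]
    (pay pay' : ∀ p : M, (∀ q, X q) → ℝ)
    (δ : ℝ) (hδ : 0 ≤ δ)
    (happrox : ∀ (p : M) (x : ∀ q, X q), |pay p x - pay' p x| ≤ δ)
    (hNE : ∃ σ : ∀ p, X p → ℝ,
      (∀ (p : M) (y : X p), 0 ≤ σ p y) ∧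
      (∀ p : M, ∑ y : X p, σ p y = 1) ∧
      (∀ (p : M) (y : X p),
        expectedPayoff (pay' p) (Function.update σ p (pointMass y))
          ≤ expectedPayoff (pay' p) σ + 0)) :
    ∃ σ : ∀ p, X p → ℝ,
      (∀ (p : M) (y : X p), 0 ≤ σ p y) ∧
      (∀ p : M, ∑ y : X p, σ p y = 1) ∧
      (∀ (p : M) (y : X p),
        expectedPayoff (pay p) (Function.update σ p (pointMass y))
          ≤ expectedPayoff (pay p) σ + 2 * δ) := by
  obtain ⟨σ, hσ, hσ_sum, hdev⟩ := hNE
  refine ⟨σ, hσ, hσ_sum, fun p y => ?_⟩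
  have hupd : ∀ q z, 0 ≤ Function.update σ p (pointMass y) q z := by
    rw [Function.forall_update_iff σ fun q τ => ∀ z : X q, 0 ≤ τ z]
    exact ⟨pointMass_nonneg y, fun q _ => hσ q⟩
  have hupd_sum : ∀ q, ∑ z, Function.update σ p (pointMass y) q z = 1 := by
    rw [Function.forall_update_iff σ fun q τ => ∑ z : X q, τ z = 1]
    exact ⟨sum_pointMass y, fun q _ => hσ_sum q⟩
  have h₁ := abs_le.mp (abs_expectedPayoff_sub_le (happrox p) hσ hσ_sum)
  have h₂ := abs_le.mp (abs_expectedPayoff_sub_le (happrox p) hupd hupd_sum)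
  linarith [hdev p y, h₁.1, h₂.2]
end
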